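/- arXiv:math/0106165 — 3 statements merged into one kernel-verified Lean document; each statement's English description precedes it below -/
import Mathlib

section
/- For a quandle X, the maps αₙ : C_n^R(X) → C_n^R(X), defined inductively by α₁ = id and α_{n+1}(x * y) = αₙ(x) * y − αₙ(x) * xₙ for x = (x₁,…,xₙ) ∈ Xⁿ and y ∈ X, form a chain map: ∂ ∘ αₙ = α_{n−1} ∘ ∂ for all n ≥ 2. -/
/-- A rack: a set with a binary operation `act a b = a^b` such that each
`fun a => a^b` is a bijection and the rack identity `(a^b)^c = (a^c)^(b^c)` holds. -/
structure RackStr (X : Type) where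
  act : X → X → X
  bij : ∀ b, Function.Bijective fun a => act a b
  distrib : ∀ a b c, act (act a b) c = act (act a c) (act b c)

variable {X : Type}

/-- The group of rack `n`-chains: the free abelian group on `Xⁿ`. -/
abbrev Ch (X : Type) (n : ℕ) := FreeAbelianGroup (Fin n → X)

/-- Face map `∂_i^0`: delete the `i`-th entry. -/
def face0 {n : ℕ} (i : Fin (n + 1)) (x : Fin (n + 1) → X) : Fin n → X :=
  fun j => x (i.succAbove j)

/-- Face map `∂_i^1`: delete the `i`-th entry and act by it on all earlier entries. -/
def face1 (R : RackStr X) {n : ℕ} (i : Fin (n + 1)) (x : Fin (n + 1) → X) : Fin n → X :=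
  fun j => if (j : ℕ) < (i : ℕ) then R.act (x j.castSucc) (x i) else x j.succ

/-- The rack boundary map `∂ = ∑ᵢ (-1)^i (∂_i^0 - ∂_i^1)` (entries indexed from 1
in the paper; here `i : Fin (n+1)` contributes sign `(-1)^(i+1)`). -/
def bdry (R : RackStr X) (n : ℕ) : Ch X (n + 1) →+ Ch X n :=
  FreeAbelianGroup.lift fun x =>
    ∑ i : Fin (n + 1), ((-1 : ℤ) ^ ((i : ℕ) + 1)) •
      (FreeAbelianGroup.of (face0 i x) - FreeAbelianGroup.of (face1 R i x))

/-- `c * y`: append `y` to each tuple, extended linearly. -/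
def star (n : ℕ) (y : X) : Ch X n →+ Ch X (n + 1) :=
  FreeAbelianGroup.lift fun x => FreeAbelianGroup.of (Fin.snoc x y)

/-- `c^y`: act by `y` on every entry, extended linearly. -/
def powy (R : RackStr X) (n : ℕ) (y : X) : Ch X n →+ Ch X n :=
  FreeAbelianGroup.lift fun x => FreeAbelianGroup.of fun i => R.act (x i) y

/-- The maps `αₙ`: `α₁ = id` and `α_{n+1}(x * y) = αₙ(x)*y - αₙ(x)*xₙ`. -/
def alpha (R : RackStr X) : (n : ℕ) → Ch X n →+ Ch X n
  | 0 => AddMonoidHom.id _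
  | 1 => AddMonoidHom.id _
  | (n + 2) => FreeAbelianGroup.lift fun v =>
      star (n + 1) (v (Fin.last (n + 1)))
          (alpha R (n + 1) (FreeAbelianGroup.of (Fin.init v))) -
        star (n + 1) (Fin.init v (Fin.last n))
          (alpha R (n + 1) (FreeAbelianGroup.of (Fin.init v)))

theorem star_of (n : ℕ) (y : X) (x : Fin n → X) :
    star n y (FreeAbelianGroup.of x) = FreeAbelianGroup.of (Fin.snoc (α := fun _ => X) x y) := by
  exact FreeAbelianGroup.lift_apply_of _ _

theorem powy_of (R : RackStr X) (n : ℕ) (y : X) (x : Fin n → X) :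
    powy R n y (FreeAbelianGroup.of x) = FreeAbelianGroup.of fun i => R.act (x i) y := by
  simp [powy]

theorem alpha_snoc (R : RackStr X) (n : ℕ) (x : Fin (n + 1) → X) (y : X) :
    alpha R (n + 2) (FreeAbelianGroup.of (Fin.snoc (α := fun _ => X) x y)) =
      star (n + 1) y (alpha R (n + 1) (FreeAbelianGroup.of x)) -
      star (n + 1) (x (Fin.last n)) (alpha R (n + 1) (FreeAbelianGroup.of x)) := by
  rw [alpha, FreeAbelianGroup.lift_apply_of]
  simp only [Fin.snoc_last, Fin.init_snoc]

theorem snoc_act (R : RackStr X) (n : ℕ) (x : Fin n → X) (y z : X) :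
    (fun i => R.act (Fin.snoc (α := fun _ => X) x y i) z) =
      Fin.snoc (α := fun _ => X) (fun i => R.act (x i) z) (R.act y z) := by
  funext i
  refine Fin.lastCases ?_ (fun j => ?_) i <;> simp

theorem powy_star (R : RackStr X) (n : ℕ) (y z : X) (c : Ch X n) :
    powy R (n + 1) z (star n y c) = star n (R.act y z) (powy R n z c) := by
  have h : (powy R (n + 1) z).comp (star n y) = (star n (R.act y z)).comp (powy R n z) := by
    ext x
    simp only [AddMonoidHom.comp_apply, star_of, powy_of, snoc_act]
  exact DFunLike.congr_fun h c

theorem alpha_powy_of (R : RackStr X) (z : X) : ∀ (n : ℕ) (x : Fin n → X),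
    alpha R n (FreeAbelianGroup.of fun i => R.act (x i) z) =
      powy R n z (alpha R n (FreeAbelianGroup.of x))
  | 0, x => by simp [alpha, powy_of]
  | 1, x => by simp [alpha, powy_of]
  | (n + 2), x => by
    obtain ⟨x, y, rfl⟩ : ∃ (w : Fin (n + 1) → X) (y : X),
        x = Fin.snoc (α := fun _ => X) w y :=
      ⟨Fin.init x, x (Fin.last _), (Fin.snoc_init_self x).symm⟩
    rw [snoc_act, alpha_snoc, alpha_snoc, map_sub, powy_star, powy_star,
      alpha_powy_of R z (n + 1) x]

theorem alpha_star_star (R : RackStr X) (n : ℕ) (y z : X) (c : Ch X n) :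
    alpha R (n + 2) (star (n + 1) y (star n z c)) =
      star (n + 1) y (alpha R (n + 1) (star n z c)) -
      star (n + 1) z (alpha R (n + 1) (star n z c)) := by
  have h : (alpha R (n + 2)).comp ((star (n + 1) y).comp (star n z)) =
      (star (n + 1) y).comp ((alpha R (n + 1)).comp (star n z)) -
      (star (n + 1) z).comp ((alpha R (n + 1)).comp (star n z)) := by
    ext x
    simp only [AddMonoidHom.comp_apply, AddMonoidHom.sub_apply,
      star_of, alpha_snoc, Fin.snoc_last]
  exact DFunLike.congr_fun h c

theorem face0_snoc_last (n : ℕ) (x : Fin n → X) (y : X) :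
    face0 (Fin.last n) (Fin.snoc (α := fun _ => X) x y) = x := by
  funext j
  simp [face0]

theorem face1_snoc_last (R : RackStr X) (n : ℕ) (x : Fin n → X) (y : X) :
    face1 R (Fin.last n) (Fin.snoc (α := fun _ => X) x y) = fun i => R.act (x i) y := by
  funext j
  simp [face1]

theorem face0_snoc_cast (n : ℕ) (x : Fin (n + 1) → X) (y : X) (i : Fin (n + 1)) :
    face0 i.castSucc (Fin.snoc (α := fun _ => X) x y) =
      Fin.snoc (α := fun _ => X) (face0 i x) y := by
  funext j
  refine Fin.lastCases ?_ (fun j => ?_) j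
  · have h : i.castSucc.succAbove (Fin.last n) = Fin.last (n + 1) := by
      rw [Fin.succAbove_of_le_castSucc]
      · simp
      · rw [Fin.castSucc_le_castSucc_iff]; exact Fin.le_last i
    simp only [face0, h, Fin.snoc_last]
  · simp only [face0, Fin.snoc_castSucc, Fin.castSucc_succAbove_castSucc]

theorem face1_snoc_cast (R : RackStr X) (n : ℕ) (x : Fin (n + 1) → X) (y : X)
    (i : Fin (n + 1)) :
    face1 R i.castSucc (Fin.snoc (α := fun _ => X) x y) =
      Fin.snoc (α := fun _ => X) (face1 R i x) y := by
  funext j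
  refine Fin.lastCases ?_ (fun j => ?_) j
  · have h : ¬ n < (i : ℕ) := by omega
    simp [face1, h]
  · have h : (j.castSucc).succ = (j.succ).castSucc := rfl
    simp only [face1, Fin.snoc_castSucc, h, Fin.val_castSucc]

theorem bdry_star (R : RackStr X) (n : ℕ) (y : X) (c : Ch X (n + 1)) :
    bdry R (n + 1) (star (n + 1) y c) =
      star n y (bdry R n c) + ((-1 : ℤ) ^ (n + 2)) • (c - powy R (n + 1) y c) := by
  have h : (bdry R (n + 1)).comp (star (n + 1) y) =
      (star n y).comp (bdry R n) +
        ((-1 : ℤ) ^ (n + 2)) • (AddMonoidHom.id _ - powy R (n + 1) y) := by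
    ext x
    simp only [AddMonoidHom.comp_apply, AddMonoidHom.sub_apply,
      AddMonoidHom.add_apply, AddMonoidHom.smul_apply, AddMonoidHom.id_apply,
      star_of, powy_of, bdry, FreeAbelianGroup.lift_apply_of]
    rw [Fin.sum_univ_castSucc]
    simp only [face0_snoc_last, face1_snoc_last, face0_snoc_cast, face1_snoc_cast,
      map_sum, map_zsmul, map_sub, star_of, Fin.val_castSucc, Fin.val_last]
  exact DFunLike.congr_fun h c

theorem exists_snoc (n : ℕ) (x : Fin (n + 1) → X) : ∃ (w : Fin n → X) (y : X),
    x = Fin.snoc (α := fun _ => X) w y :=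
  ⟨Fin.init x, x (Fin.last _), (Fin.snoc_init_self x).symm⟩

theorem alpha_key (R : RackStr X) (hq : ∀ a, R.act a a = a) (y : X) :
    ∀ (n : ℕ) (x : Fin (n + 1) → X),
    alpha R (n + 1) (star n y (bdry R n (FreeAbelianGroup.of x))) +
        ((-1 : ℤ) ^ (n + 2)) • alpha R (n + 1) (FreeAbelianGroup.of x) =
      star n y (alpha R n (bdry R n (FreeAbelianGroup.of x))) -
      star n (x (Fin.last n)) (alpha R n (bdry R n (FreeAbelianGroup.of x))) +
        ((-1 : ℤ) ^ (n + 2)) •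
          powy R (n + 1) (x (Fin.last n)) (alpha R (n + 1) (FreeAbelianGroup.of x))
  | 0, x => by
    have h0 : bdry R 0 (FreeAbelianGroup.of x) = 0 := by
      have : face0 0 x = face1 R 0 x := Subsingleton.elim _ _
      simp [bdry, this]
    have h1 : (fun i => R.act (x i) (x (Fin.last 0))) = x := by
      funext i
      have hi : i = Fin.last 0 := by omega
      rw [hi, hq]
    rw [h0]
    simp only [map_zero, alpha, AddMonoidHom.id_apply, powy_of, h1, sub_zero]
  | (n + 1), x => by
    obtain ⟨w, z, rfl⟩ := exists_snoc _ x
    rw [← star_of, bdry_star, Fin.snoc_last]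
    simp only [map_add, map_sub, map_zsmul, alpha_star_star, powy_of, star_of, alpha_snoc,
      powy_star, hq, alpha_powy_of]
    rw [pow_succ (-1 : ℤ) (n + 2)]
    generalize (-1 : ℤ) ^ (n + 2) = s
    module

/-- For a quandle, `α` is a chain map. -/
theorem stmt10 (R : RackStr X) (hq : ∀ a, R.act a a = a) (n : ℕ) :
    (bdry R (n + 1)).comp (alpha R (n + 2)) = (alpha R (n + 1)).comp (bdry R (n + 1)) := by
  induction n with
  | zero =>
    ext x
    obtain ⟨w, z, rfl⟩ := exists_snoc _ x
    have k := alpha_key R hq z 0 w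
    simp only [AddMonoidHom.comp_apply]
    rw [alpha_snoc, ← star_of, map_sub, bdry_star, bdry_star, bdry_star]
    simp only [map_add, map_sub, map_zsmul, powy_of, alpha_powy_of]
    rw [← sub_eq_zero] at k ⊢
    rw [← neg_eq_zero, ← k]
    simp only [alpha, AddMonoidHom.id_apply]
    module
  | succ n ih =>
    ext x
    obtain ⟨w, z, rfl⟩ := exists_snoc _ x
    have k := alpha_key R hq z (n + 1) w
    have h := DFunLike.congr_fun ih (FreeAbelianGroup.of w)
    simp only [AddMonoidHom.comp_apply] at h
    simp only [AddMonoidHom.comp_apply]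
    rw [alpha_snoc, ← star_of, map_sub, bdry_star, bdry_star, bdry_star, h]
    simp only [map_add, map_sub, map_zsmul, powy_of, alpha_powy_of]
    rw [← sub_eq_zero] at k ⊢
    rw [← neg_eq_zero, ← k]
    module
end

section
/- For a quandle X, the map r : C_{n−1}^R(X) → C_n^D(X), r(x₁,…,x_{n−1}) = (x₁,x₁,x₂,…,x_{n−1}), is an injective chain map (where C_*^R is shifted by one in degree). -/
variable {X : Type}

/-- Degenerate tuples: some two consecutive entries are equal. -/
def Deg (X : Type) (n : ℕ) : Set (Fin n → X) :=
  {v | ∃ i j : Fin n, (i : ℕ) + 1 = (j : ℕ) ∧ v i = v j}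

/-- The degenerate subgroup `C_n^D(X)`. -/
def CD (X : Type) (n : ℕ) : AddSubgroup (Ch X n) :=
  AddSubgroup.closure (FreeAbelianGroup.of '' Deg X n)

/-- The map `r(x₁,…,x_{n-1}) = (x₁,x₁,x₂,…,x_{n-1})`, extended linearly. -/
def rmap (X : Type) (n : ℕ) : Ch X (n + 1) →+ Ch X (n + 2) :=
  FreeAbelianGroup.lift fun v => FreeAbelianGroup.of (Fin.cons (v 0) v)

theorem face_zero_eq (R : RackStr X) {n : ℕ} (x : Fin (n + 1) → X) :
    face0 0 x = face1 R 0 x := by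
  funext j; simp [face0, face1]

theorem face0_cons {n : ℕ} (k : Fin (n + 1)) (v : Fin (n + 2) → X) :
    face0 k.succ.succ (Fin.cons (v 0) v : Fin (n + 3) → X)
      = Fin.cons (face0 k.succ v 0) (face0 k.succ v) := by
  funext j
  refine Fin.cases ?_ (fun j => ?_) j
  · simp [face0]
  · simp [face0]

theorem face1_cons (R : RackStr X) {n : ℕ} (k : Fin (n + 1)) (v : Fin (n + 2) → X) :
    face1 R k.succ.succ (Fin.cons (v 0) v : Fin (n + 3) → X)
      = Fin.cons (face1 R k.succ v 0) (face1 R k.succ v) := by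
  funext j
  refine Fin.cases ?_ (fun j => ?_) j
  · simp [face1]
  · simp [face1, ← Fin.succ_castSucc]

theorem face_one_cons (R : RackStr X) (hq : ∀ a, R.act a a = a) {n : ℕ}
    (v : Fin (n + 2) → X) :
    face0 (Fin.succ 0) (Fin.cons (v 0) v : Fin (n + 3) → X)
      = face1 R (Fin.succ 0) (Fin.cons (v 0) v : Fin (n + 3) → X) := by
  funext j
  refine Fin.cases ?_ (fun j => ?_) j
  · simp only [face0, face1, Fin.cons_succ]
    simp [hq]
  · simp only [face0, face1, Fin.cons_succ]
    simp

/-- `r` is an injective chain map `C_{*-1}^R(X) → C_*^D(X)` (with respect to the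
shifted grading, whose differential is `-∂`). -/
theorem stmt13 (R : RackStr X) (hq : ∀ a, R.act a a = a) :
    (∀ n : ℕ, Function.Injective (rmap X n)) ∧
    (∀ (n : ℕ) (c : Ch X (n + 1)), rmap X n c ∈ CD X (n + 2)) ∧
    (∀ n : ℕ, (bdry R (n + 2)).comp (rmap X (n + 1)) =
      -((rmap X n).comp (bdry R (n + 1)))) := by
  refine ⟨fun n => ?_, fun n c => ?_, fun n => ?_⟩
  · have h : (FreeAbelianGroup.lift fun w : Fin (n + 2) → X =>
        FreeAbelianGroup.of (Fin.tail w)).comp (rmap X n) = AddMonoidHom.id _ := by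
      ext v
      simp [rmap]
    exact Function.LeftInverse.injective fun c => DFunLike.congr_fun h c
  · induction c using FreeAbelianGroup.induction_on with
    | zero => simp
    | of v =>
      refine AddSubgroup.subset_closure ⟨Fin.cons (v 0) v, ⟨0, 1, by simp, ?_⟩, by simp [rmap]⟩
      exact (Fin.cons_succ (α := fun _ => X) (v 0) v 0).symm
    | neg v h => rw [map_neg]; exact neg_mem h
    | add a b ha hb => rw [map_add]; exact add_mem ha hb
  · ext v
    simp only [AddMonoidHom.comp_apply, AddMonoidHom.neg_apply, rmap, bdry,
      FreeAbelianGroup.lift_apply_of, map_sum, map_zsmul, map_sub]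
    rw [Fin.sum_univ_succ, Fin.sum_univ_succ, face_zero_eq R, face_one_cons R hq,
      Fin.sum_univ_succ (n := n + 1), face_zero_eq R]
    simp only [sub_self, smul_zero, zero_add, ← Finset.sum_neg_distrib]
    refine Finset.sum_congr rfl fun k _ => ?_
    rw [face0_cons, face1_cons, ← neg_smul]
    congr 1
    simp [pow_succ]
end

section
/- Let X be a finite rack with homogeneous orbits. Then for every n, the n-th rack Betti number of X equals that of its orbit rack: rank H_n^R(X) = mⁿ where m = |Orb X| (for n ≥ 1), and the torsion subgroup of H_n^R(X) is annihilated by |X|ⁿ. -/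
variable {X : Type}

/-- The set of orbits of a rack. -/
def Orb (R : RackStr X) : Type := Quot fun a b => ∃ c, R.act a c = b

/-- Same-orbit relation. -/
def orbRel (R : RackStr X) : X → X → Prop :=
  Relation.EqvGen fun a b => ∃ c, R.act a c = b

/-- `N a b` is the number of `c` with `a^c = b`. -/
noncomputable def Nf (R : RackStr X) (a b : X) : ℕ :=
  Nat.card {c : X // R.act a c = b}

/-- Homogeneous orbits: `N a b` depends only on the common orbit of `a,b`. -/
def Homog (R : RackStr X) : Prop :=
  ∀ a b a' b', orbRel R a b → orbRel R b a' → orbRel R a' b' → Nf R a b = Nf R a' b'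

/-- The `(n+1)`-cycles. -/
def Zc (R : RackStr X) (n : ℕ) : AddSubgroup (Ch X (n + 1)) := (bdry R n).ker

/-- The `(n+1)`-boundaries, viewed inside the cycles. -/
def Bc (R : RackStr X) (n : ℕ) : AddSubgroup (Zc R n) :=
  AddSubgroup.comap (Zc R n).subtype (bdry R (n + 1)).range

/-- The rack homology group `H_{n+1}^R(X)`. -/
abbrev Hrack (R : RackStr X) (n : ℕ) := Zc R n ⧸ Bc R n

theorem exists_perm_of_fiber {X Z : Type} [Fintype X] (f g : X → Z)
    (h : ∀ z, Nat.card {y // f y = z} = Nat.card {y // g y = z}) :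
    ∃ e : X ≃ X, ∀ y, g (e y) = f y := by
  have e : ∀ z, {y // f y = z} ≃ {y // g y = z} := fun z =>
    (Nonempty.some (by
      rw [← Finite.card_eq]; exact h z))
  refine ⟨(Equiv.sigmaFiberEquiv f).symm.trans
    ((Equiv.sigmaCongrRight e).trans (Equiv.sigmaFiberEquiv g)), fun y => ?_⟩
  simp only [Equiv.trans_apply]
  exact (e (f y) ⟨y, rfl⟩).2

theorem orbRel_act (R : RackStr X) (a c : X) : orbRel R a (R.act a c) :=
  Relation.EqvGen.rel _ _ ⟨c, rfl⟩

theorem perm_of_orb (R : RackStr X) [Fintype X] (hh : Homog R) (a b : X) (hab : orbRel R a b) :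
    ∃ e : X ≃ X, ∀ y, R.act b (e y) = R.act a y := by
  refine exists_perm_of_fiber _ _ fun z => ?_
  by_cases hz : orbRel R a z
  · exact hh a z b z hz ((hz.symm).trans _ _ _ hab) ((hab.symm).trans _ _ _ hz)
  · have h1 : IsEmpty {y // R.act a y = z} :=
      ⟨fun y => hz (y.2 ▸ orbRel_act R a y.1)⟩
    have h2 : IsEmpty {y // R.act b y = z} :=
      ⟨fun y => hz (hab.trans _ _ _ (y.2 ▸ orbRel_act R b y.1))⟩
    simp

theorem perm_of_act (R : RackStr X) [Fintype X] (hh : Homog R) (a w : X) :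
    ∃ e : X ≃ X, ∀ y, R.act a (e y) = R.act (R.act a y) w := by
  obtain ⟨e, he⟩ := perm_of_orb R hh (R.act a w) a ((orbRel_act R a w).symm)
  refine ⟨(Equiv.ofBijective _ (R.bij w)).trans e, fun y => ?_⟩
  simp [he, R.distrib a y w]

/-- Symmetrised tuple. -/
def tup (R : RackStr X) {n : ℕ} (k : ℕ) (x : Fin n → X) (y : Fin k → X) : Fin n → X :=
  fun i => if h : (i : ℕ) < k then R.act (x i) (y ⟨i, h⟩) else x i

def Asym (R : RackStr X) [Fintype X] (n k : ℕ) : Ch X n →+ Ch X n :=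
  FreeAbelianGroup.lift fun x => ∑ y : Fin k → X, FreeAbelianGroup.of (tup R k x y)

def insT {n : ℕ} (p : ℕ) (y : X) (x : Fin n → X) : Fin (n + 1) → X :=
  fun i => if h : (i : ℕ) < p ∧ (i : ℕ) < n then x ⟨i, h.2⟩
    else if h' : (i : ℕ) ≤ p then y else x ⟨i - 1, by have := i.2; omega⟩

def hom (X : Type) [Fintype X] (n p : ℕ) : Ch X n →+ Ch X (n + 1) :=
  FreeAbelianGroup.lift fun x => ∑ y : X, FreeAbelianGroup.of (insT p y x)

def dd (R : RackStr X) (n : ℕ) (j : Fin (n + 1)) : Ch X (n + 1) →+ Ch X n :=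
  FreeAbelianGroup.map (face0 j) - FreeAbelianGroup.map (face1 R j)

theorem bdry_eq (R : RackStr X) (n : ℕ) (c : Ch X (n + 1)) :
    bdry R n c = ∑ j : Fin (n + 1), ((-1 : ℤ) ^ ((j : ℕ) + 1)) • dd R n j c := by
  have : bdry R n = ∑ j : Fin (n + 1), ((-1 : ℤ) ^ ((j : ℕ) + 1)) • dd R n j := by
    ext x
    simp [bdry, dd]
  rw [this]; simp

theorem face0_eq {n : ℕ} (i : Fin (n + 1)) (x : Fin (n + 1) → X) (j : Fin n) :
    face0 i x j = if (j : ℕ) < (i : ℕ) then x j.castSucc else x j.succ := by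
  unfold face0
  by_cases h : (j : ℕ) < i
  · rw [Fin.succAbove_of_castSucc_lt _ _ (by simpa [Fin.lt_def] using h), if_pos h]
  · rw [Fin.succAbove_of_le_castSucc _ _ (by simpa [Fin.le_def] using h), if_neg h]

theorem orb_faces (R : RackStr X) {n : ℕ} (i : Fin (n + 1)) (x : Fin (n + 1) → X) (j : Fin n) :
    orbRel R (face0 i x j) (face1 R i x j) := by
  rw [face0_eq]; unfold face1
  split_ifs
  · exact orbRel_act R _ _
  · exact Relation.EqvGen.refl _

/-- The symmetrisation only depends on orbits. -/
theorem Asym_orb (R : RackStr X) [Fintype X] (hh : Homog R) {n k : ℕ} (x x' : Fin n → X)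
    (h : ∀ i, orbRel R (x i) (x' i)) (h' : ∀ i : Fin n, k ≤ (i : ℕ) → x i = x' i) :
    Asym R n k (.of x) = Asym R n k (.of x') := by
  have : ∀ i : Fin k, ∃ e : X ≃ X, ∀ (hi : (i : ℕ) < n) (y),
      R.act (x' ⟨i, hi⟩) (e y) = R.act (x ⟨i, hi⟩) y := by
    intro i
    by_cases hi : (i : ℕ) < n
    · obtain ⟨e, he⟩ := perm_of_orb R hh _ _ (h ⟨i, hi⟩)
      exact ⟨e, fun _ => he⟩
    · exact ⟨Equiv.refl _, fun h => absurd h hi⟩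
  choose e he using this
  simp only [Asym, FreeAbelianGroup.lift_apply_of]
  refine Fintype.sum_equiv (Equiv.piCongrRight e) _ _ fun y => ?_
  congr 1
  ext i
  simp only [tup]
  split_ifs with hi
  · simpa using (he ⟨i, hi⟩ i.2 (y ⟨i, hi⟩)).symm
  · exact h' i (by omega)

theorem Asym_dd_zero (R : RackStr X) [Fintype X] (hh : Homog R) {n k : ℕ} (j : Fin (n + 1))
    (hj : (j : ℕ) ≤ k) (c : Ch X (n + 1)) : Asym R n k (dd R n j c) = 0 := by
  have : (Asym R n k).comp (dd R n j) = 0 := by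
    ext x
    simp only [dd, AddMonoidHom.comp_apply, AddMonoidHom.sub_apply, FreeAbelianGroup.map_of_apply,
      map_sub, AddMonoidHom.zero_apply, sub_eq_zero,
      Finset.sum_sub_distrib]
    refine Asym_orb R hh _ _ (orb_faces R j x) fun i hi => ?_
    rw [face0_eq, face1, if_neg (by omega), if_neg (by omega)]
  exact DFunLike.congr_fun this c

theorem dd_Asym_zero (R : RackStr X) [Fintype X] (hh : Homog R) {n k : ℕ} (j : Fin (n + 1))
    (hj : (j : ℕ) ≤ k) (c : Ch X (n + 1)) : dd R n j (Asym R (n + 1) k c) = 0 := by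
  have : (dd R n j).comp (Asym R (n + 1) k) = 0 := by
    ext x
    simp only [dd, AddMonoidHom.comp_apply, AddMonoidHom.sub_apply, Asym,
      FreeAbelianGroup.lift_apply_of, map_sum, FreeAbelianGroup.map_of_apply,
      AddMonoidHom.zero_apply, sub_eq_zero,
      Finset.sum_sub_distrib]
    have : ∀ (i : Fin k) (w : X), ∃ e : X ≃ X, ∀ (hi : (i : ℕ) < n + 1) (y),
        R.act (x ⟨i, hi⟩) (e y) = R.act (R.act (x ⟨i, hi⟩) y) w := by
      intro i w
      by_cases hi : (i : ℕ) < n + 1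
      · obtain ⟨e, he⟩ := perm_of_act R hh (x ⟨i, hi⟩) w
        exact ⟨e, fun _ => he⟩
      · exact ⟨Equiv.refl _, fun h => absurd h hi⟩
    choose e he using this
    let F : (Fin k → X) → (Fin k → X) := fun y i =>
      if (i : ℕ) < j then e i (tup R k x y j) (y i) else y i
    have hFj : ∀ y, tup R k x (F y) j = tup R k x y j := by
      intro y; simp [tup, F]
    have hF : Function.Injective F := by
      intro y y' hy
      have h1 : tup R k x y j = tup R k x y' j := by
        rw [← hFj y, ← hFj y', hy]
      ext i
      have := congrFun hy i
      simp only [F, h1] at this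
      split_ifs at this with h
      · exact (e i _).injective this
      · exact this
    symm
    refine Fintype.sum_bijective F (Finite.injective_iff_bijective.1 hF) _ _ fun y => ?_
    congr 1
    ext i
    rw [face0_eq, face1]
    split_ifs with h
    · have hik : (i : ℕ) < k := by omega
      have := he ⟨i, hik⟩ (tup R k x y j) (show (i : ℕ) < n + 1 by have := i.2; omega) (y ⟨i, hik⟩)
      have h1 : tup R k x y i.castSucc = R.act (x i.castSucc) (y ⟨i, hik⟩) := by
        simp [tup, hik]
      have h2 : tup R k x (F y) i.castSucc =
          R.act (x i.castSucc) (e ⟨i, hik⟩ (tup R k x y j) (y ⟨i, hik⟩)) := by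
        rw [tup, dif_pos (by simpa using hik)]
        simp only [F, Fin.val_castSucc, if_pos h]
      rw [h1, h2]
      exact this.symm
    · have h2 : ¬ ((i.succ : Fin (n + 1)) : ℕ) < j := by simp only [Fin.val_succ]; omega
      simp only [tup, F, if_neg h2]
  exact DFunLike.congr_fun this c

theorem dd_Asym_comm (R : RackStr X) [Fintype X] {n k : ℕ} (j : Fin (n + 1))
    (hj : k ≤ (j : ℕ)) (c : Ch X (n + 1)) :
    dd R n j (Asym R (n + 1) k c) = Asym R n k (dd R n j c) := by
  have : (dd R n j).comp (Asym R (n + 1) k) = (Asym R n k).comp (dd R n j) := by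
    ext x
    simp only [dd, AddMonoidHom.comp_apply, AddMonoidHom.sub_apply, Asym,
      FreeAbelianGroup.lift_apply_of, map_sum, FreeAbelianGroup.map_of_apply, map_sub,
      Finset.sum_sub_distrib]
    congr 1
    · refine Finset.sum_congr rfl fun y _ => ?_
      congr 1
      ext i
      simp only [face0_eq, tup, Fin.val_castSucc, Fin.val_succ]
      have := i.2
      split_ifs <;> first | rfl | omega
    · refine Fintype.sum_equiv (Equiv.piCongrRight fun _ => Equiv.ofBijective _ (R.bij (x j))) _ _
        fun y => ?_
      congr 1
      ext i
      have := i.2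
      simp only [face1, tup, Fin.val_castSucc, Fin.val_succ, dif_neg (not_lt.2 hj)]
      split_ifs <;> first | rfl | omega | simp [R.distrib _ _ (x j)]
  exact DFunLike.congr_fun this c

theorem bdry_Asym (R : RackStr X) [Fintype X] (hh : Homog R) {n k : ℕ} (c : Ch X (n + 1)) :
    bdry R n (Asym R (n + 1) k c) = Asym R n k (bdry R n c) := by
  rw [bdry_eq, bdry_eq, map_sum]
  refine Finset.sum_congr rfl fun j _ => ?_
  rw [map_zsmul]
  congr 1
  rcases le_total (j : ℕ) k with h | h
  · rw [Asym_dd_zero R hh j h, dd_Asym_zero R hh j h]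
  · exact dd_Asym_comm R j h c

theorem dd_hom_lt (R : RackStr X) [Fintype X] {n k : ℕ} (j : Fin (n + 1)) (_hk : k ≤ n)
    (hj : (j : ℕ) ≤ k) (c : Ch X (n + 1)) :
    dd R (n + 1) j.castSucc (hom X (n + 1) (k + 1) c) = hom X n k (dd R n j c) := by
  have : (dd R (n + 1) j.castSucc).comp (hom X (n + 1) (k + 1)) = (hom X n k).comp (dd R n j) := by
    ext x
    simp only [dd, AddMonoidHom.comp_apply, AddMonoidHom.sub_apply, hom,
      FreeAbelianGroup.lift_apply_of, map_sum, FreeAbelianGroup.map_of_apply, map_sub,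
      Finset.sum_sub_distrib]
    congr 1
    · refine Finset.sum_congr rfl fun y _ => ?_
      congr 1
      ext i
      have := i.2
      simp only [face0_eq, insT, Fin.val_castSucc, Fin.val_succ]
      split_ifs <;> first | rfl | omega | (congr 1; ext; simp; done) | (congr 1; ext; simp; omega)
    · refine Finset.sum_congr rfl fun y _ => ?_
      congr 1
      ext i
      have := i.2
      simp only [face1, insT, Fin.val_castSucc, Fin.val_succ]
      split_ifs <;> first | rfl | omega | (congr 1; ext; simp; done) | (congr 1; ext; simp; omega)
  exact DFunLike.congr_fun this c

theorem dd_hom_gt (R : RackStr X) [Fintype X] {n k : ℕ} (j : Fin (n + 1))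
    (hj : k < (j : ℕ)) (c : Ch X (n + 1)) :
    dd R (n + 1) j.succ (hom X (n + 1) (k + 1) c) = hom X n (k + 1) (dd R n j c) := by
  have : (dd R (n + 1) j.succ).comp (hom X (n + 1) (k + 1)) =
      (hom X n (k + 1)).comp (dd R n j) := by
    ext x
    simp only [dd, AddMonoidHom.comp_apply, AddMonoidHom.sub_apply, hom,
      FreeAbelianGroup.lift_apply_of, map_sum, FreeAbelianGroup.map_of_apply, map_sub,
      Finset.sum_sub_distrib]
    have hj2 := j.2
    congr 1
    · refine Finset.sum_congr rfl fun y _ => ?_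
      congr 1
      ext i
      have := i.2
      simp only [face0_eq, insT, Fin.val_castSucc, Fin.val_succ]
      split_ifs <;> first | rfl | omega | (congr 1; ext; simp; done) | (congr 1; ext; simp; omega)
    · refine Fintype.sum_equiv (Equiv.ofBijective _ (R.bij (x j))) _ _ fun y => ?_
      congr 1
      ext i
      have := i.2
      simp only [face1, insT, Fin.val_castSucc, Fin.val_succ]
      split_ifs <;> first | rfl | omega | (congr 1; ext; simp; done) | (congr 1; ext; simp; omega)
  exact DFunLike.congr_fun this c

theorem dd_hom_eq (R : RackStr X) [Fintype X] (hh : Homog R) {n k : ℕ} (hk : k < n + 1)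
    (c : Ch X (n + 1)) :
    dd R (n + 1) ⟨k + 1, by omega⟩ (hom X (n + 1) (k + 1) (Asym R (n + 1) k c)) =
      Fintype.card X • Asym R (n + 1) k c - Asym R (n + 1) (k + 1) c := by
  have : (dd R (n + 1) ⟨k + 1, by omega⟩).comp ((hom X (n + 1) (k + 1)).comp (Asym R (n + 1) k)) =
      Fintype.card X • Asym R (n + 1) k - Asym R (n + 1) (k + 1) := by
    ext x
    simp only [dd, AddMonoidHom.comp_apply, AddMonoidHom.sub_apply, hom, Asym,
      FreeAbelianGroup.lift_apply_of, map_sum, FreeAbelianGroup.map_of_apply, Finset.sum_sub_distrib,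
      AddMonoidHom.nsmul_apply]
    congr 1
    · rw [Finset.smul_sum]
      refine Finset.sum_congr rfl fun y _ => ?_
      have : ∀ w : X, face0 ⟨k + 1, by omega⟩ (insT (k + 1) w (tup R k x y)) = tup R k x y := by
        intro w
        ext i
        have := i.2
        simp only [face0_eq, insT, Fin.val_castSucc, Fin.val_succ]
        split_ifs <;> first | rfl | omega
      simp [this]
    · have : ∀ (i : Fin k) (w : X), ∃ e : X ≃ X, ∀ (hi : (i : ℕ) < n + 1) (y),
          R.act (x ⟨i, hi⟩) (e y) = R.act (R.act (x ⟨i, hi⟩) y) w := by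
        intro i w
        obtain ⟨e, he⟩ := perm_of_act R hh (x ⟨i, by omega⟩) w
        exact ⟨e, fun _ => he⟩
      choose e he using this
      rw [Finset.sum_comm, ← Fintype.sum_prod_type',
        ← (Fin.snocEquiv fun _ : Fin (k + 1) => X).sum_comp, Fintype.sum_prod_type,
        Fintype.sum_prod_type]
      refine Finset.sum_congr rfl fun w _ => ?_
      refine Fintype.sum_equiv (Equiv.piCongrRight fun i => e i w) _ _ fun y => ?_
      congr 1
      ext i
      have := i.2
      simp only [face1, insT, tup, Fin.val_castSucc, Fin.val_succ, Fin.snocEquiv, Equiv.coe_fn_mk,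
        Fin.snoc]
      split_ifs <;> first
        | omega
        | rfl
        | exact (he ⟨i, by assumption⟩ w i.2 _).symm
  exact DFunLike.congr_fun this c

theorem homotopy_step (R : RackStr X) [Fintype X] (hh : Homog R) {n k : ℕ} (hk : k < n + 1)
    (c : Ch X (n + 1)) (hc : bdry R n c = 0) :
    Fintype.card X • Asym R (n + 1) k c - Asym R (n + 1) (k + 1) c ∈ (bdry R (n + 1)).range := by
  have key : bdry R (n + 1) (hom X (n + 1) (k + 1) (Asym R (n + 1) k c)) =
      ((-1 : ℤ) ^ (k + 1 + 1)) •
        (Fintype.card X • Asym R (n + 1) k c - Asym R (n + 1) (k + 1) c) := by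
    rw [bdry_eq, Fin.sum_univ_succAbove _ (⟨k + 1, by omega⟩ : Fin (n + 2)), dd_hom_eq R hh hk]
    have h0 : ∑ j : Fin (n + 1), ((-1 : ℤ) ^ (((⟨k + 1, by omega⟩ : Fin (n + 2)).succAbove j : ℕ) + 1)) •
        dd R (n + 1) ((⟨k + 1, by omega⟩ : Fin (n + 2)).succAbove j)
          (hom X (n + 1) (k + 1) (Asym R (n + 1) k c)) =
        ∑ j : Fin (n + 1), -hom X n (k + 1) (((-1 : ℤ) ^ ((j : ℕ) + 1)) •
          dd R n j (Asym R (n + 1) k c)) := by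
      refine Finset.sum_congr rfl fun j _ => ?_
      rcases le_or_gt (j : ℕ) k with h | h
      · rw [Fin.succAbove_of_castSucc_lt _ _ (by simp [Fin.lt_def]; omega),
          dd_hom_lt R j (by omega) h, dd_Asym_zero R hh j h]
        simp
      · rw [Fin.succAbove_of_le_castSucc _ _ (by simp [Fin.le_def]; omega),
          dd_hom_gt R j h, map_zsmul]
        simp [pow_succ]
    rw [h0, Finset.sum_neg_distrib, ← map_sum, ← bdry_eq, bdry_Asym R hh, hc]
    simp
  have : Fintype.card X • Asym R (n + 1) k c - Asym R (n + 1) (k + 1) c =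
      ((-1 : ℤ) ^ (k + 1 + 1)) • bdry R (n + 1) (hom X (n + 1) (k + 1) (Asym R (n + 1) k c)) := by
    rw [key, smul_smul, ← mul_pow]; simp
  rw [this]
  exact AddSubgroup.zsmul_mem _ (AddMonoidHom.mem_range.2 ⟨_, rfl⟩) _

theorem Asym_zero (R : RackStr X) [Fintype X] (n : ℕ) (c : Ch X n) : Asym R n 0 c = c := by
  have : Asym R n 0 = AddMonoidHom.id _ := by
    ext x
    have : ∀ y, tup R 0 x y = x := fun y => by ext i; simp [tup]
    simp [Asym, this]
  rw [this]; rfl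

theorem homotopy_all (R : RackStr X) [Fintype X] (hh : Homog R) {n k : ℕ} (hk : k ≤ n + 1)
    (c : Ch X (n + 1)) (hc : bdry R n c = 0) :
    Fintype.card X ^ k • c - Asym R (n + 1) k c ∈ (bdry R (n + 1)).range := by
  induction k with
  | zero => simp [Asym_zero]
  | succ k ih =>
    have h1 := AddSubgroup.nsmul_mem _ (ih (by omega)) (Fintype.card X)
    have h2 := AddSubgroup.add_mem _ h1 (homotopy_step R hh (by omega : k < n + 1) c hc)
    rw [smul_sub, smul_smul, ← pow_succ'] at h2
    simpa using h2

/-- The orbit of an element. -/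
def toOrb (R : RackStr X) (a : X) : Orb R := Quot.mk _ a

/-- A representative of an orbit. -/
noncomputable def rep (R : RackStr X) (o : Orb R) : X := Quot.out o

theorem toOrb_rep (R : RackStr X) (o : Orb R) : toOrb R (rep R o) = o := Quot.out_eq o

/-- Projection to chains of the orbit rack. -/
def proj (R : RackStr X) (n : ℕ) : Ch X n →+ Ch (Orb R) n :=
  FreeAbelianGroup.map fun x i => toOrb R (x i)

theorem orb_eq_iff (R : RackStr X) (a b : X) :
    toOrb R a = toOrb R b ↔ orbRel R a b := Quot.eq

theorem proj_bdry (R : RackStr X) (n : ℕ) (c : Ch X (n + 1)) : proj R n (bdry R n c) = 0 := by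
  rw [bdry_eq, map_sum]
  refine Finset.sum_eq_zero fun j _ => ?_
  rw [map_zsmul]
  have : (proj R n).comp (dd R n j) = 0 := by
    ext x
    simp only [dd, proj, AddMonoidHom.comp_apply, AddMonoidHom.sub_apply,
      FreeAbelianGroup.map_of_apply, map_sub, AddMonoidHom.zero_apply, sub_eq_zero]
    congr 1
    funext i
    exact (orb_eq_iff R _ _).2 (orb_faces R j x i)
  have := DFunLike.congr_fun this c
  simp only [AddMonoidHom.comp_apply] at this
  rw [this]; simp

/-- Lift of orbit chains to symmetric chains. -/
noncomputable def lft (R : RackStr X) [Fintype X] (n : ℕ) : Ch (Orb R) n →+ Ch X n :=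
  FreeAbelianGroup.lift fun o => Asym R n n (.of fun i => rep R (o i))

theorem lft_proj (R : RackStr X) [Fintype X] (hh : Homog R) (n : ℕ) (c : Ch X n) :
    lft R n (proj R n c) = Asym R n n c := by
  have : (lft R n).comp (proj R n) = Asym R n n := by
    ext x
    simp only [lft, proj, AddMonoidHom.comp_apply, FreeAbelianGroup.map_of_apply,
      FreeAbelianGroup.lift_apply_of]
    refine Asym_orb R hh _ _ (fun i => ?_) fun i hi => absurd i.2 (by omega)
    rw [← orb_eq_iff]
    exact toOrb_rep R _
  exact DFunLike.congr_fun this c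

theorem proj_lft (R : RackStr X) [Fintype X] (n : ℕ) (c : Ch (Orb R) n) :
    proj R n (lft R n c) = Fintype.card X ^ n • c := by
  have : (proj R n).comp (lft R n) = Fintype.card X ^ n • AddMonoidHom.id _ := by
    ext o
    simp only [lft, proj, AddMonoidHom.comp_apply, Asym, map_sum, FreeAbelianGroup.map_of_apply,
      FreeAbelianGroup.lift_apply_of, AddMonoidHom.nsmul_apply, AddMonoidHom.id_apply]
    have : ∀ y : Fin n → X, (fun i => toOrb R (tup R n (fun i => rep R (o i)) y i)) = o := by
      intro y
      funext i
      simp only [tup, i.2, dif_pos]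
      exact ((orb_eq_iff R _ _).2 (orbRel_act R _ _)).symm.trans (toOrb_rep R _)
    simp [this]
  exact DFunLike.congr_fun this c

theorem bdry_lft (R : RackStr X) [Fintype X] (hh : Homog R) (n : ℕ) (c : Ch (Orb R) (n + 1)) :
    bdry R n (lft R (n + 1) c) = 0 := by
  have : (bdry R n).comp (lft R (n + 1)) = 0 := by
    ext o
    simp only [lft, AddMonoidHom.comp_apply, FreeAbelianGroup.lift_apply_of,
      AddMonoidHom.zero_apply]
    rw [bdry_eq]
    exact Finset.sum_eq_zero fun j _ => by rw [dd_Asym_zero R hh j (by omega)]; simp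
  exact DFunLike.congr_fun this c

/-- The induced map on homology. -/
def projH (R : RackStr X) (n : ℕ) : Hrack R n →+ Ch (Orb R) (n + 1) :=
  QuotientAddGroup.lift (Bc R n) ((proj R (n + 1)).comp (Zc R n).subtype) (by
    rintro ⟨c, hc⟩ ⟨d, hd⟩
    simp only [AddMonoidHom.mem_ker, AddMonoidHom.comp_apply]
    rw [← hd]
    exact proj_bdry R (n + 1) d)

theorem projH_zero (R : RackStr X) [Fintype X] (hh : Homog R) (n : ℕ) (h : Hrack R n)
    (h0 : projH R n h = 0) : Fintype.card X ^ (n + 1) • h = 0 := by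
  induction h using QuotientAddGroup.induction_on with
  | H z =>
    have hp : proj R (n + 1) z.1 = 0 := h0
    have h1 := homotopy_all R hh le_rfl z.1 z.2
    rw [← lft_proj R hh, hp, map_zero, sub_zero] at h1
    rw [← QuotientAddGroup.mk_nsmul, QuotientAddGroup.eq_zero_iff]
    exact h1

instance orb_finite (R : RackStr X) [Fintype X] : Finite (Orb R) := by
  unfold Orb; infer_instance

theorem smul_inj (R : RackStr X) [Fintype X] (n : ℕ) (a : Ch (Orb R) (n + 1))
    (h : Fintype.card X ^ (n + 1) • a = 0) : a = 0 := by
  rcases isEmpty_or_nonempty X with hX | hX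
  · have : IsEmpty (Orb R) := ⟨fun o => hX.false (rep R o)⟩
    have := (FreeAbelianGroup.equivFinsupp (Fin (n + 1) → Orb R)).injective.subsingleton
    exact Subsingleton.elim _ _
  · apply (FreeAbelianGroup.equivFinsupp (Fin (n + 1) → Orb R)).injective
    have h1 := congrArg (FreeAbelianGroup.equivFinsupp (Fin (n + 1) → Orb R)) h
    rw [map_nsmul, map_zero] at h1
    rw [map_zero]
    exact (smul_eq_zero.1 h1).resolve_left (pow_ne_zero _ Fintype.card_ne_zero)

theorem torsion_eq (R : RackStr X) [Fintype X] (hh : Homog R) (n : ℕ) :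
    AddCommGroup.torsion (Hrack R n) = (projH R n).ker := by
  ext h
  rw [AddCommGroup.mem_torsion, AddMonoidHom.mem_ker]
  constructor
  · intro hf
    obtain ⟨k, hk, hk'⟩ := isOfFinAddOrder_iff_nsmul_eq_zero.1 hf
    have h1 := congrArg (projH R n) hk'
    rw [map_nsmul, map_zero] at h1
    apply (FreeAbelianGroup.equivFinsupp (Fin (n + 1) → Orb R)).injective
    have h2 := congrArg (FreeAbelianGroup.equivFinsupp (Fin (n + 1) → Orb R)) h1
    rw [map_nsmul, map_zero] at h2
    rw [map_zero]
    exact (smul_eq_zero.1 h2).resolve_left hk.ne'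
  · intro h0
    rcases isEmpty_or_nonempty X with hX | hX
    · have h1 := (FreeAbelianGroup.equivFinsupp (Fin (n + 1) → X)).injective.subsingleton
      have : h = 0 := by
        induction h using QuotientAddGroup.induction_on with
        | H z => rw [Subsingleton.elim z 0]; rfl
      rw [this]; exact IsOfFinAddOrder.zero
    · exact isOfFinAddOrder_iff_nsmul_eq_zero.2
        ⟨_, pow_pos Fintype.card_pos _, projH_zero R hh n h h0⟩

theorem range_equiv (R : RackStr X) [Fintype X] (hh : Homog R) (n : ℕ) :
    Nonempty ((projH R n).range ≃+ (Fin (Nat.card (Orb R) ^ (n + 1)) → ℤ)) := by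
  let b := FreeAbelianGroup.basis (Fin (n + 1) → Orb R)
  have : Module.Finite ℤ (Ch (Orb R) (n + 1)) := Module.Finite.of_basis b
  have : Module.Free ℤ (Ch (Orb R) (n + 1)) := Module.Free.of_basis b
  have hr : Module.finrank ℤ (Ch (Orb R) (n + 1)) = Nat.card (Orb R) ^ (n + 1) := by
    have := Fintype.ofFinite (Orb R)
    classical
    rw [Module.finrank_eq_card_basis b]
    simp
  let S : Submodule ℤ (Ch (Orb R) (n + 1)) := (projH R n).range.toIntSubmodule
  have hmem : ∀ a : Ch (Orb R) (n + 1), (Fintype.card X ^ (n + 1) : ℕ) • a ∈ S := by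
    intro a
    refine ⟨QuotientAddGroup.mk ⟨lft R (n + 1) a, bdry_lft R hh n a⟩, ?_⟩
    exact proj_lft R (n + 1) a
  let f : Ch (Orb R) (n + 1) →ₗ[ℤ] S :=
    LinearMap.codRestrict S ((Fintype.card X ^ (n + 1) : ℕ) • LinearMap.id) hmem
  have hf : Function.Injective f := by
    rw [← LinearMap.ker_eq_bot, LinearMap.ker_eq_bot']
    intro a ha
    exact smul_inj R n a (congrArg Subtype.val ha)
  have e1 := LinearMap.finrank_le_finrank_of_injective hf
  have e2 := Submodule.finrank_le S
  have hS : Module.finrank ℤ S = Nat.card (Orb R) ^ (n + 1) := by omega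
  exact ⟨((Module.finBasisOfFinrankEq ℤ S hS).equivFun).toAddEquiv⟩

/-- For a finite rack with homogeneous orbits: `H_{n+1}^R(X)` modulo torsion is
free abelian of rank `m^{n+1}` where `m = |Orb X|` (so the Betti numbers agree
with those of the orbit rack), and the torsion subgroup is annihilated by
`|X|^{n+1}`. -/
theorem stmt17 (R : RackStr X) [Fintype X] (hh : Homog R) (n : ℕ) :
    Nonempty ((Hrack R n ⧸ AddCommGroup.torsion (Hrack R n)) ≃+
      (Fin (Nat.card (Orb R) ^ (n + 1)) → ℤ)) ∧
    ∀ h ∈ AddCommGroup.torsion (Hrack R n), (Fintype.card X) ^ (n + 1) • h = 0 := by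
  constructor
  · obtain ⟨e⟩ := range_equiv R hh n
    exact ⟨(QuotientAddGroup.quotientAddEquivOfEq (torsion_eq R hh n)).trans
      ((QuotientAddGroup.quotientKerEquivRange (projH R n)).trans e)⟩
  · intro h ht
    rw [torsion_eq R hh n] at ht
    exact projH_zero R hh n h ht
end
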